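/- Let D ∈ ℝ^{E×V}, let Γ ∈ ℝ^{V×V} and Λ ∈ ℝ^{E×E} be positive definite diagonal matrices with κ := ‖Γ^{1/2} Dᵀ Λ^{1/2}‖₂, and Q = {x ∈ ℝ^V : x[i] = x̃_i for all i ∈ M} nonempty. Let (x̂^{(k)}, ŷ^{(k)})_{k≥0} be generated by the SLP update rule with initialization x̂^{(−1)} = x̂^{(0)} ∈ ℝ^V, ŷ^{(0)} ∈ ℝ^E. Then for every K ≥ 1, every x ∈ Q, and every y with ‖y‖_∞ ≤ 1: 2 Σ_{k=1}^{K} ( yᵀD x̂^{(k)} − (ŷ^{(k)})ᵀD x ) + (1−κ) ‖y − ŷ^{(K)}‖²_{Λ⁻¹} + ‖x − x̂^{(K)}‖²_{Γ⁻¹} + (1−κ) Σ_{k=1}^{K} ‖ŷ^{(k)} − ŷ^{(k−1)}‖²_{Λ⁻¹} + (1−κ) Σ_{k=1}^{K−1} ‖x̂^{(k)} − x̂^{(k−1)}‖²_{Γ⁻¹} + (1−κ) ‖x̂^{(K)} − x̂^{(K−1)}‖²_{Γ⁻¹} ≤ ‖y − ŷ^{(0)}‖²_{Λ⁻¹} +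 ‖x − x̂^{(0)}‖²_{Γ⁻¹}. -/

import Mathlib

open Matrix Finset

noncomputable section

/-- The ℓ¹-norm of a finitely indexed real vector. -/
def l1Norm {ι : Type*} [Fintype ι] (u : ι → ℝ) : ℝ := ∑ i, |u i|

/-- The squared weighted norm `‖u‖²_Q = uᵀ Q u`. -/
def wnormSq {ι : Type*} [Fintype ι] (Q : Matrix ι ι ℝ) (u : ι → ℝ) : ℝ := u ⬝ᵥ (Q *ᵥ u)

/-- The closed ℓ∞ unit ball `{y : ‖y‖_∞ ≤ 1}`. -/
def linfBall (ι : Type*) : Set (ι → ℝ) := {y | ∀ e, |y e| ≤ 1}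

/-- `a` minimizes `f` over the set `S`. -/
def IsMinimizer {α : Type*} (S : Set α) (f : α → ℝ) (a : α) : Prop :=
  a ∈ S ∧ ∀ b ∈ S, f a ≤ f b

/-- Entrywise square root of the diagonal matrix with diagonal `g`. -/
def diagSqrt {ι : Type*} [Fintype ι] [DecidableEq ι] (g : ι → ℝ) : Matrix ι ι ℝ :=
  Matrix.diagonal (fun i => Real.sqrt (g i))

/-- The spectral norm `‖A‖₂ = sup_{‖u‖₂ = 1} ‖A u‖₂` of a real matrix. -/
def specNorm {m n : Type*} [Fintype m] [Fintype n] [DecidableEq n] (A : Matrix m n ℝ) : ℝ :=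
  ‖LinearMap.toContinuousLinearMap (Matrix.toEuclideanLin A)‖

/-- Objective of the dual resolvent step: `z ↦ ½ (ŷ + Λ D x̄ − z)ᵀ Λ⁻¹ (ŷ + Λ D x̄ − z)`. -/
def slpDualObj {V E : Type*} [Fintype V] [Fintype E] [DecidableEq E]
    (D : Matrix E V ℝ) (Λ : Matrix E E ℝ) (yk : E → ℝ) (xbar : V → ℝ) (z : E → ℝ) : ℝ :=
  (1/2) * wnormSq Λ⁻¹ (yk + Λ *ᵥ (D *ᵥ xbar) - z)

/-- Objective of the primal resolvent step: `z ↦ ½ (x̂ − Γ Dᵀ v − z)ᵀ Γ⁻¹ (x̂ − Γ Dᵀ v − z)`. -/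
def slpPrimalObj {V E : Type*} [Fintype V] [Fintype E] [DecidableEq V]
    (D : Matrix E V ℝ) (Γ : Matrix V V ℝ) (xk : V → ℝ) (v : E → ℝ) (z : V → ℝ) : ℝ :=
  (1/2) * wnormSq Γ⁻¹ (xk - Γ *ᵥ (Dᵀ *ᵥ v) - z)

/-- The SLP update rule: starting from `xs 0` (with `x^{(-1)} = x^{(0)}`, encoded via truncated
subtraction `0 - 1 = 0`) and `ys 0`, the iterate `ys (k+1)` minimizes the dual resolvent
objective over the ℓ∞ unit ball and `xs (k+1)` minimizes the primal resolvent objective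
over the constraint set `Q`. -/
def SLPSequences {V E : Type*} [Fintype V] [Fintype E] [DecidableEq V] [DecidableEq E]
    (D : Matrix E V ℝ) (Γ : Matrix V V ℝ) (Λ : Matrix E E ℝ) (Q : Set (V → ℝ))
    (xs : ℕ → V → ℝ) (ys : ℕ → E → ℝ) : Prop :=
  ∀ k : ℕ,
    IsMinimizer (linfBall E) (slpDualObj D Λ (ys k) ((2:ℝ) • xs k - xs (k-1))) (ys (k+1)) ∧
    IsMinimizer Q (slpPrimalObj D Γ (xs k) (ys (k+1))) (xs (k+1))

/-- An empirical graph: an undirected weighted graph together with a fixed orientation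
assigning each edge `e` a head `e⁺` and a tail `e⁻`, with positive weights, no self-loops,
and distinct edges joining distinct node pairs. -/
structure EmpiricalGraph (V E : Type*) where
  head : E → V
  tail : E → V
  w : E → ℝ
  w_pos : ∀ e, 0 < w e
  no_self_loop : ∀ e, head e ≠ tail e
  edge_inj : Function.Injective (fun e => ({head e, tail e} : Set V))

/-- The simple graph underlying an empirical graph. -/
def EmpiricalGraph.toSimpleGraph {V E : Type*} (G : EmpiricalGraph V E) : SimpleGraph V :=
  SimpleGraph.fromRel (fun i j => ∃ e, G.head e = i ∧ G.tail e = j)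

/-- Weighted node degree `d_i = ∑_{j ∈ N(i)} W_{i,j}`. -/
def EmpiricalGraph.deg {V E : Type*} [Fintype E] [DecidableEq V]
    (G : EmpiricalGraph V E) (i : V) : ℝ :=
  ∑ e, ((if G.head e = i then G.w e else 0) + (if G.tail e = i then G.w e else 0))

/-- Weighted oriented incidence matrix `D ∈ ℝ^{E×V}`: `D_{e,e⁺} = W_e`, `D_{e,e⁻} = −W_e`. -/
def EmpiricalGraph.incidence {V E : Type*} [DecidableEq V]
    (G : EmpiricalGraph V E) : Matrix E V ℝ :=
  Matrix.of fun e i => if G.head e = i then G.w e else if G.tail e = i then -G.w e else 0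


/-- A quadratic `t ↦ t² N - 2 t c` that is nonnegative on `(0, 1]` has `c ≤ 0`. -/
theorem nonpos_of_two_mul_le_sq_mul {c N : ℝ}
    (h : ∀ t : ℝ, 0 < t → t ≤ 1 → 2 * t * c ≤ t ^ 2 * N) : c ≤ 0 := by
  by_contra! hc
  have h1 := h 1 one_pos le_rfl
  have hN : 0 < N := by linarith
  have h2 := h (c / N) (by positivity) ((div_le_one hN).2 (by linarith))
  have h3 : (c / N) ^ 2 * N = c / N * c := by field_simp
  have h4 : 0 < c / N * c := by positivity
  linarith

theorem dotProduct_mulVec_comm_of_isSymm {ι : Type*} [Fintype ι] {G : Matrix ι ι ℝ}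
    (hG : G.IsSymm) (u v : ι → ℝ) : u ⬝ᵥ (G *ᵥ v) = v ⬝ᵥ (G *ᵥ u) := by
  rw [dotProduct_mulVec, ← mulVec_transpose, hG.eq, dotProduct_comm]

theorem wnormSq_add {ι : Type*} [Fintype ι] {G : Matrix ι ι ℝ}
    (hG : G.IsSymm) (u v : ι → ℝ) :
    wnormSq G (u + v) = wnormSq G u + 2 * (u ⬝ᵥ (G *ᵥ v)) + wnormSq G v := by
  simp only [wnormSq, mulVec_add, dotProduct_add, add_dotProduct]
  rw [dotProduct_mulVec_comm_of_isSymm hG v u]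
  ring

theorem wnormSq_smul {ι : Type*} [Fintype ι] (G : Matrix ι ι ℝ) (t : ℝ) (u : ι → ℝ) :
    wnormSq G (t • u) = t ^ 2 * wnormSq G u := by
  simp only [wnormSq, mulVec_smul, dotProduct_smul, smul_dotProduct, smul_eq_mul]
  ring

theorem wnormSq_zero {ι : Type*} [Fintype ι] (G : Matrix ι ι ℝ) : wnormSq G 0 = 0 := by
  simp [wnormSq]

/-- Variational inequality for the projection of `p` onto a convex set in a weighted norm. -/
theorem IsMinimizer.dotProduct_mulVec_nonpos {ι : Type*} [Fintype ι] {G : Matrix ι ι ℝ}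
    (hG : G.IsSymm) {S : Set (ι → ℝ)} (hS : Convex ℝ S) {p a b : ι → ℝ}
    (h : IsMinimizer S (fun z => (1/2) * wnormSq G (p - z)) a) (hb : b ∈ S) :
    (p - a) ⬝ᵥ (G *ᵥ (b - a)) ≤ 0 := by
  refine nonpos_of_two_mul_le_sq_mul (N := wnormSq G (b - a)) fun t ht ht1 => ?_
  have hmin := h.2 _ (hS.add_smul_sub_mem h.1 hb ⟨ht.le, ht1⟩)
  have hp : p - (a + t • (b - a)) = (p - a) + (-t) • (b - a) := by
    simp only [neg_smul]
    abel
  simp only [hp, wnormSq_add hG, wnormSq_smul, mulVec_smul, dotProduct_smul, smul_eq_mul] at hmin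
  linarith

/-- Three-point inequality for a resolvent step `a` from `u` in direction `w`. -/
theorem IsMinimizer.three_point {ι : Type*} [Fintype ι] [DecidableEq ι] {H : Matrix ι ι ℝ}
    (hH : H.IsSymm) (hdet : IsUnit H.det) {S : Set (ι → ℝ)} (hS : Convex ℝ S)
    {u w a b : ι → ℝ}
    (h : IsMinimizer S (fun z => (1/2) * wnormSq H⁻¹ (u + H *ᵥ w - z)) a) (hb : b ∈ S) :
    2 * (w ⬝ᵥ (b - a)) + wnormSq H⁻¹ (a - u) + wnormSq H⁻¹ (b - a) ≤ wnormSq H⁻¹ (b - u) := by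
  have hG : (H⁻¹).IsSymm := by rw [Matrix.IsSymm, transpose_nonsing_inv, hH.eq]
  have hvar := h.dotProduct_mulVec_nonpos hG hS hb
  have hw : (H *ᵥ w) ⬝ᵥ (H⁻¹ *ᵥ (b - a)) = w ⬝ᵥ (b - a) := by
    rw [dotProduct_mulVec_comm_of_isSymm hG, mulVec_mulVec, nonsing_inv_mul _ hdet, one_mulVec, dotProduct_comm]
  have hp : u + H *ᵥ w - a = H *ᵥ w - (a - u) := by abel
  have hbu : b - u = (a - u) + (b - a) := by abel
  rw [hp, sub_dotProduct, hw] at hvar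
  rw [hbu, wnormSq_add hG]
  linarith

theorem convex_linfBall (ι : Type*) : Convex ℝ (linfBall ι) := by
  have h : linfBall ι = ⋂ e, {y : ι → ℝ | y e ∈ Set.Icc (-1 : ℝ) 1} := by
    ext y
    simp [linfBall, abs_le]
  rw [h]
  exact convex_iInter fun e =>
    (convex_Icc (-1 : ℝ) 1).is_linear_preimage (LinearMap.proj (R := ℝ) e).isLinear

theorem convex_setOf_forall_mem_eq {ι : Type*} (M : Set ι) (f : ι → ℝ) :
    Convex ℝ {x : ι → ℝ | ∀ i ∈ M, x i = f i} := by
  intro x hx y hy s t _ _ hst i hi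
  simp only [Pi.add_apply, Pi.smul_apply, smul_eq_mul, hx i hi, hy i hi]
  rw [← add_mul, hst, one_mul]

theorem wnormSq_inv_diagonal {ι : Type*} [Fintype ι] [DecidableEq ι] {g : ι → ℝ}
    (hg : ∀ i, 0 < g i) (u : ι → ℝ) :
    wnormSq (Matrix.diagonal g)⁻¹ u = ∑ i, (u i / √(g i)) ^ 2 := by
  have hinv : (Matrix.diagonal g)⁻¹ = Matrix.diagonal fun i => (g i)⁻¹ := by
    refine inv_eq_left_inv ?_
    rw [diagonal_mul_diagonal, ← diagonal_one]
    congr 1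
    ext i
    exact inv_mul_cancel₀ (hg i).ne'
  rw [hinv, wnormSq, dotProduct]
  refine Finset.sum_congr rfl fun i _ => ?_
  rw [mulVec_diagonal, div_pow, Real.sq_sqrt (hg i).le]
  ring

theorem dotProduct_mulVec_le_specNorm {m n : Type*} [Fintype m] [Fintype n] [DecidableEq n]
    (A : Matrix m n ℝ) (u : m → ℝ) (v : n → ℝ) :
    2 * (u ⬝ᵥ (A *ᵥ v)) ≤ specNorm A * (∑ j, v j ^ 2 + ∑ i, u i ^ 2) := by
  have hA := (LinearMap.toContinuousLinearMap (Matrix.toEuclideanLin A)).le_opNorm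
    (WithLp.toLp 2 v)
  have hCS := real_inner_le_norm (WithLp.toLp 2 u) (WithLp.toLp 2 (A *ᵥ v))
  have hin : inner ℝ (WithLp.toLp 2 u) (WithLp.toLp 2 (A *ᵥ v)) = u ⬝ᵥ (A *ᵥ v) := by
    simp [PiLp.inner_apply, dotProduct, mul_comm]
  have hu := EuclideanSpace.real_norm_sq_eq (WithLp.toLp 2 u)
  have hv := EuclideanSpace.real_norm_sq_eq (WithLp.toLp 2 v)
  have hκ : 0 ≤ specNorm A := norm_nonneg _
  change ‖WithLp.toLp 2 (A *ᵥ v)‖ ≤ specNorm A * ‖WithLp.toLp 2 v‖ at hA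
  rw [hin] at hCS
  simp only at hu hv
  rw [← hu, ← hv]
  nlinarith [mul_le_mul_of_nonneg_left hA (norm_nonneg (WithLp.toLp 2 u)),
    mul_nonneg hκ (sq_nonneg (‖WithLp.toLp 2 u‖ - ‖WithLp.toLp 2 v‖))]

/-- Weighted Young inequality for the coupling term, with the scaled spectral norm. -/
theorem two_mul_dotProduct_mulVec_le {V E : Type*} [Fintype V] [Fintype E] [DecidableEq V]
    [DecidableEq E] (D : Matrix E V ℝ) {γ : V → ℝ} (hγ : ∀ i, 0 < γ i) {lam : E → ℝ}
    (hlam : ∀ e, 0 < lam e) (a : E → ℝ) (b : V → ℝ) :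
    2 * (a ⬝ᵥ (D *ᵥ b)) ≤ specNorm (diagSqrt γ * Dᵀ * diagSqrt lam) *
      (wnormSq (Matrix.diagonal lam)⁻¹ a + wnormSq (Matrix.diagonal γ)⁻¹ b) := by
  have key := dotProduct_mulVec_le_specNorm (diagSqrt γ * Dᵀ * diagSqrt lam)
    (fun i => b i / √(γ i)) (fun e => a e / √(lam e))
  rw [wnormSq_inv_diagonal hlam, wnormSq_inv_diagonal hγ]
  have ha : diagSqrt lam *ᵥ (fun e => a e / √(lam e)) = a := by
    ext e
    rw [diagSqrt, mulVec_diagonal, mul_div_cancel₀]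
    exact (Real.sqrt_pos.2 (hlam e)).ne'
  have hb : (fun i => b i / √(γ i)) ᵥ* diagSqrt γ = b := by
    ext i
    rw [diagSqrt, vecMul_diagonal, div_mul_cancel₀]
    exact (Real.sqrt_pos.2 (hγ i)).ne'
  rwa [← mulVec_mulVec, ha, ← mulVec_mulVec, dotProduct_mulVec, hb, mulVec_transpose,
    dotProduct_comm, ← dotProduct_mulVec] at key

theorem isUnit_det_diagonal {ι : Type*} [Fintype ι] [DecidableEq ι] {g : ι → ℝ}
    (hg : ∀ i, 0 < g i) : IsUnit (Matrix.diagonal g).det := by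
  rw [det_diagonal]
  exact (Finset.prod_pos fun i _ => hg i).ne'.isUnit

/-- One step of the SLP iteration, in terms of the extrapolated primal point. -/
theorem SLPSequences.step {V E : Type*} [Fintype V] [Fintype E] [DecidableEq V] [DecidableEq E]
    {D : Matrix E V ℝ} {γ : V → ℝ} (hγ : ∀ i, 0 < γ i) {lam : E → ℝ} (hlam : ∀ e, 0 < lam e)
    {Q : Set (V → ℝ)} (hQ : Convex ℝ Q) {xs : ℕ → V → ℝ} {ys : ℕ → E → ℝ}
    (hseq : SLPSequences D (Matrix.diagonal γ) (Matrix.diagonal lam) Q xs ys)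
    (k : ℕ) {x : V → ℝ} (hx : x ∈ Q) {y : E → ℝ} (hy : y ∈ linfBall E) :
    2 * (y ⬝ᵥ (D *ᵥ xs (k+1)) - ys (k+1) ⬝ᵥ (D *ᵥ x)) +
        2 * ((y - ys k) ⬝ᵥ (D *ᵥ (xs k - xs (k-1)))) -
        2 * ((ys (k+1) - ys k) ⬝ᵥ (D *ᵥ (xs k - xs (k-1)))) -
        2 * ((y - ys (k+1)) ⬝ᵥ (D *ᵥ (xs (k+1) - xs k))) +
        wnormSq (Matrix.diagonal lam)⁻¹ (ys (k+1) - ys k) +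
        wnormSq (Matrix.diagonal γ)⁻¹ (xs (k+1) - xs k) +
        wnormSq (Matrix.diagonal lam)⁻¹ (y - ys (k+1)) +
        wnormSq (Matrix.diagonal γ)⁻¹ (x - xs (k+1)) ≤
      wnormSq (Matrix.diagonal lam)⁻¹ (y - ys k) + wnormSq (Matrix.diagonal γ)⁻¹ (x - xs k) := by
  obtain ⟨hdual, hprimal⟩ := hseq k
  have hd := IsMinimizer.three_point (isSymm_diagonal lam) (isUnit_det_diagonal hlam)
    (convex_linfBall E) hdual hy
  have hprimal' : IsMinimizer Q (fun z => (1/2) * wnormSq (Matrix.diagonal γ)⁻¹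
      (xs k + Matrix.diagonal γ *ᵥ (-(Dᵀ *ᵥ ys (k+1))) - z)) (xs (k+1)) := by
    simp only [mulVec_neg, ← sub_eq_add_neg]
    exact hprimal
  have hp := hprimal'.three_point (isSymm_diagonal γ) (isUnit_det_diagonal hγ) hQ hx
  rw [dotProduct_comm] at hd
  rw [neg_dotProduct, mulVec_transpose, ← dotProduct_mulVec] at hp
  simp only [mulVec_sub, mulVec_smul, dotProduct_sub, sub_dotProduct, dotProduct_smul,
    smul_eq_mul] at hd hp ⊢
  linarith

/-- Telescoped SLP estimate that keeps the last coupling term. -/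
theorem SLPSequences.telescope {V E : Type*} [Fintype V] [Fintype E] [DecidableEq V]
    [DecidableEq E] {D : Matrix E V ℝ} {γ : V → ℝ} (hγ : ∀ i, 0 < γ i) {lam : E → ℝ}
    (hlam : ∀ e, 0 < lam e) {Q : Set (V → ℝ)} (hQ : Convex ℝ Q) {xs : ℕ → V → ℝ}
    {ys : ℕ → E → ℝ}
    (hseq : SLPSequences D (Matrix.diagonal γ) (Matrix.diagonal lam) Q xs ys)
    {κ : ℝ} (hκ : κ = specNorm (diagSqrt γ * Dᵀ * diagSqrt lam))
    {x : V → ℝ} (hx : x ∈ Q) {y : E → ℝ} (hy : y ∈ linfBall E) (K : ℕ) :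
    2 * (∑ k ∈ Finset.Icc 1 K, (y ⬝ᵥ (D *ᵥ xs k) - ys k ⬝ᵥ (D *ᵥ x))) +
        wnormSq (Matrix.diagonal lam)⁻¹ (y - ys K) +
        wnormSq (Matrix.diagonal γ)⁻¹ (x - xs K) +
        (1 - κ) * (∑ k ∈ Finset.Icc 1 K, wnormSq (Matrix.diagonal lam)⁻¹ (ys k - ys (k-1))) +
        (1 - κ) *
          (∑ k ∈ Finset.Icc 1 (K-1), wnormSq (Matrix.diagonal γ)⁻¹ (xs k - xs (k-1))) +
        wnormSq (Matrix.diagonal γ)⁻¹ (xs K - xs (K-1)) -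
        2 * ((y - ys K) ⬝ᵥ (D *ᵥ (xs K - xs (K-1)))) ≤
      wnormSq (Matrix.diagonal lam)⁻¹ (y - ys 0) +
        wnormSq (Matrix.diagonal γ)⁻¹ (x - xs 0) := by
  induction K with
  | zero => simp [wnormSq_zero]
  | succ K ih =>
    have hstep := hseq.step hγ hlam hQ K hx hy
    have hcross := two_mul_dotProduct_mulVec_le D hγ hlam (ys (K+1) - ys K) (xs K - xs (K-1))
    rw [← hκ] at hcross
    have hsum : ∑ k ∈ Finset.Icc 1 K, wnormSq (Matrix.diagonal γ)⁻¹ (xs k - xs (k-1)) =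
        ∑ k ∈ Finset.Icc 1 (K-1), wnormSq (Matrix.diagonal γ)⁻¹ (xs k - xs (k-1)) +
          wnormSq (Matrix.diagonal γ)⁻¹ (xs K - xs (K-1)) := by
      cases K with
      | zero => simp [wnormSq_zero]
      | succ n => simp [Finset.sum_Icc_succ_top]
    rw [Finset.sum_Icc_succ_top (by omega), Finset.sum_Icc_succ_top (by omega)]
    simp only [Nat.add_sub_cancel]
    rw [hsum]
    linarith

/-- telescoped estimate for the SLP iterations. For positive definite
diagonal `Γ = diag γ`, `Λ = diag lam`, `κ = ‖Γ^{1/2} Dᵀ Λ^{1/2}‖₂`, and SLP iterates,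
for every `K ≥ 1`, `x ∈ Q` and `‖y‖_∞ ≤ 1`:
`2 ∑_{k=1}^K (yᵀDx̂⁽ᵏ⁾ − (ŷ⁽ᵏ⁾)ᵀDx) + (1−κ)‖y − ŷ⁽ᴷ⁾‖²_{Λ⁻¹} + ‖x − x̂⁽ᴷ⁾‖²_{Γ⁻¹}
+ (1−κ)∑_{k=1}^K ‖ŷ⁽ᵏ⁾ − ŷ⁽ᵏ⁻¹⁾‖²_{Λ⁻¹} + (1−κ)∑_{k=1}^{K−1} ‖x̂⁽ᵏ⁾ − x̂⁽ᵏ⁻¹⁾‖²_{Γ⁻¹}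
+ (1−κ)‖x̂⁽ᴷ⁾ − x̂⁽ᴷ⁻¹⁾‖²_{Γ⁻¹} ≤ ‖y − ŷ⁽⁰⁾‖²_{Λ⁻¹} + ‖x − x̂⁽⁰⁾‖²_{Γ⁻¹}`. -/
theorem slp_telescoped_estimate
    {V E : Type*} [Fintype V] [Fintype E] [DecidableEq V] [DecidableEq E]
    (D : Matrix E V ℝ)
    (γ : V → ℝ) (hγ : ∀ i, 0 < γ i) (lam : E → ℝ) (hlam : ∀ e, 0 < lam e)
    (κ : ℝ) (hκ : κ = specNorm (diagSqrt γ * Dᵀ * diagSqrt lam))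
    (M : Set V) (xtil : V → ℝ)
    (Q : Set (V → ℝ)) (hQ : Q = {x : V → ℝ | ∀ i ∈ M, x i = xtil i})
    (hQne : Q.Nonempty)
    (xs : ℕ → V → ℝ) (ys : ℕ → E → ℝ)
    (hseq : SLPSequences D (Matrix.diagonal γ) (Matrix.diagonal lam) Q xs ys) :
    ∀ K : ℕ, 1 ≤ K → ∀ x ∈ Q, ∀ y ∈ linfBall E,
      2 * (∑ k ∈ Finset.Icc 1 K, (y ⬝ᵥ (D *ᵥ xs k) - ys k ⬝ᵥ (D *ᵥ x))) +
          (1 - κ) * wnormSq (Matrix.diagonal lam)⁻¹ (y - ys K) +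
          wnormSq (Matrix.diagonal γ)⁻¹ (x - xs K) +
          (1 - κ) * (∑ k ∈ Finset.Icc 1 K, wnormSq (Matrix.diagonal lam)⁻¹ (ys k - ys (k-1))) +
          (1 - κ) *
            (∑ k ∈ Finset.Icc 1 (K-1), wnormSq (Matrix.diagonal γ)⁻¹ (xs k - xs (k-1))) +
          (1 - κ) * wnormSq (Matrix.diagonal γ)⁻¹ (xs K - xs (K-1)) ≤
        wnormSq (Matrix.diagonal lam)⁻¹ (y - ys 0) +
          wnormSq (Matrix.diagonal γ)⁻¹ (x - xs 0) := by
  intro K _ x hx y hy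
  have hconv : Convex ℝ Q := hQ ▸ convex_setOf_forall_mem_eq M xtil
  have htel := hseq.telescope hγ hlam hconv hκ hx hy K
  have hcross := two_mul_dotProduct_mulVec_le D hγ hlam (y - ys K) (xs K - xs (K-1))
  rw [← hκ] at hcross
  linarith

end
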